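/- Let (ūⁱ, T̄_i) be a minimizer of P(t_i, x*(t_i)) with coefficients ε_i ∈ [0,1], ρ_i ≥ 1 and trajectory x̄ⁱ, with T̄_i ≥ T_min + δ, and suppose P(t_i + δ, x̄ⁱ(t_i+δ)) with updated coefficients ε_{i+1} ∈ [0,1], ρ_{i+1} ≥ 1 attains its minimum with optimal value V(x*(t_i+δ)). If the update satisfies (ε_{i+1} − ε_i) ∫_{t_i+δ}^{t_i+T̄_i} L(x̄ⁱ, ūⁱ) ds + (ρ_{i+1} − ρ_i) q(x̄ⁱ(t_i+T̄_i)) ≤ δ + (1−ξ) ε_i ∫_{t_i}^{t_i+δ} L(x̄ⁱ, ūⁱ) ds, then V(x*(t_i+δ)) − V(x*(t_i)) ≤ −ξ ε_i ∫_{t_i}^{t_i+δ} L(x̄ⁱ(s), ūⁱ(s)) ds. -/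

import Mathlib

open Set MeasureTheory Filter Topology Matrix

noncomputable section

/-- `ℝⁿ` with the Euclidean norm. -/
abbrev Vec (n : ℕ) := EuclideanSpace ℝ (Fin n)

/-- A function is piecewise continuous on a set if it is continuous off a
finite set of points. -/
def PiecewiseContinuousOn {m : ℕ} (u : ℝ → Vec m) (s : Set ℝ) : Prop :=
  ∃ D : Finset ℝ, ContinuousOn u (s \ (D : Set ℝ))

/-- The compact control box `U = {u : u_min ≤ u ≤ u_max componentwise}`. -/
def ControlBox {m : ℕ} (umin umax : Vec m) : Set (Vec m) :=
  {u | ∀ j, umin j ≤ u j ∧ u j ≤ umax j}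

/-- `x` solves `ẋ(τ) = f(x(τ), u(τ))` on the set `s`. -/
def IsTrajectoryOn {n m : ℕ} (f : Vec n → Vec m → Vec n)
    (x : ℝ → Vec n) (u : ℝ → Vec m) (s : Set ℝ) : Prop :=
  ∀ τ ∈ s, HasDerivAt x (f (x τ) (u τ)) τ

/-- The control `u` (with response `x`) is admissible at `xt` on `[t, t+T]`:
piecewise continuous, `U`-valued, solving the system from `xt`, with terminal
state in `Ω`. -/
structure IsAdmissible {n m : ℕ} (f : Vec n → Vec m → Vec n)
    (Uset : Set (Vec m)) (Ω : Set (Vec n))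
    (t T : ℝ) (xt : Vec n) (u : ℝ → Vec m) (x : ℝ → Vec n) : Prop where
  pc : PiecewiseContinuousOn u (Icc t (t + T))
  memU : ∀ s ∈ Icc t (t + T), u s ∈ Uset
  traj : IsTrajectoryOn f x u (Icc t (t + T))
  init : x t = xt
  term : x (t + T) ∈ Ω

/-- Class `𝒦` function: continuous, strictly increasing, vanishing at `0`. -/
def ClassK (φ : ℝ → ℝ) : Prop :=
  ContinuousOn φ (Ici 0) ∧ StrictMonoOn φ (Ici 0) ∧ φ 0 = 0

/-- The quadratic form `xᵀ M x`. -/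
def quadForm {k : ℕ} (M : Matrix (Fin k) (Fin k) ℝ) (x : Vec k) : ℝ :=
  ∑ i, ∑ j, x i * M i j * x j

/-- The cost `J(u, T; x_t) = T + ε ∫ₜ^{t+T} L(x,u) + ρ q(x(t+T))`. -/
def cost {n m : ℕ} (L : Vec n → Vec m → ℝ) (q : Vec n → ℝ)
    (ε ρ t T : ℝ) (x : ℝ → Vec n) (u : ℝ → Vec m) : ℝ :=
  T + ε * (∫ s in t..(t + T), L (x s) (u s)) + ρ * q (x (t + T))

/-- `(ū, T̄, x̄)` solves problem `P(t, x_t)`: it is admissible with `T̄ ≥ T_min`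
and minimizes the cost among all admissible pairs with horizon `≥ T_min`. -/
structure IsMinimizer {n m : ℕ} (f : Vec n → Vec m → Vec n)
    (Uset : Set (Vec m)) (Ω : Set (Vec n)) (L : Vec n → Vec m → ℝ) (q : Vec n → ℝ)
    (ε ρ Tmin t : ℝ) (xt : Vec n)
    (ubar : ℝ → Vec m) (Tbar : ℝ) (xbar : ℝ → Vec n) : Prop where
  hT : Tmin ≤ Tbar
  adm : IsAdmissible f Uset Ω t Tbar xt ubar xbar
  opt : ∀ (u : ℝ → Vec m) (T : ℝ) (x : ℝ → Vec n), Tmin ≤ T →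
      IsAdmissible f Uset Ω t T xt u x →
      cost L q ε ρ t Tbar xbar ubar ≤ cost L q ε ρ t T x u

/-- Stabilizing assumption: from every point of `Ω` there is a piecewise
continuous `U`-valued control on `[0,δ]` whose trajectory stays in `Ω` and
satisfies `(d/dτ) q(x_s(τ)) + L(x_s(τ), u_s(τ)) ≤ 0`. -/
def StabilizingAssumption {n m : ℕ} (f : Vec n → Vec m → Vec n)
    (Uset : Set (Vec m)) (Ω : Set (Vec n))
    (L : Vec n → Vec m → ℝ) (q : Vec n → ℝ) (δ : ℝ) : Prop :=
  ∀ x0 ∈ Ω, ∃ (us : ℝ → Vec m) (xs : ℝ → Vec n),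
    PiecewiseContinuousOn us (Icc 0 δ) ∧
    (∀ τ ∈ Icc (0:ℝ) δ, us τ ∈ Uset) ∧
    IsTrajectoryOn f xs us (Icc 0 δ) ∧ xs 0 = x0 ∧
    (∀ τ ∈ Icc (0:ℝ) δ, xs τ ∈ Ω) ∧
    (∀ τ ∈ Icc (0:ℝ) δ, ∃ dq : ℝ,
      HasDerivAt (fun s => q (xs s)) dq τ ∧ dq + L (xs τ) (us τ) ≤ 0)

theorem isCompact_controlBox {m : ℕ} (umin umax : Vec m) :
    IsCompact (ControlBox umin umax) := by
  have h := (isCompact_univ_pi fun j => isCompact_Icc (a := umin j) (b := umax j)).image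
    (PiLp.continuous_toLp 2 fun _ : Fin m => ℝ)
  convert h using 1
  ext u
  exact ⟨fun hu => ⟨u.ofLp, fun j _ => hu j, rfl⟩, by rintro ⟨v, hv, rfl⟩ j; exact hv j trivial⟩

/-- A continuous running cost is integrable along a continuous path and a piecewise continuous
control with values in a compact set. -/
theorem PiecewiseContinuousOn.integrableOn_runningCost {n m : ℕ} {L : Vec n → Vec m → ℝ}
    (hL : Continuous fun p : Vec n × Vec m => L p.1 p.2) {K : Set (Vec m)} (hK : IsCompact K)
    {x : ℝ → Vec n} {u : ℝ → Vec m} {a b : ℝ} (hx : ContinuousOn x (Icc a b))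
    (hu : PiecewiseContinuousOn u (Icc a b)) (huK : ∀ s ∈ Icc a b, u s ∈ K) :
    IntegrableOn (fun s => L (x s) (u s)) (Icc a b) := by
  obtain ⟨D, hD⟩ := hu
  obtain ⟨C, hC⟩ := ((isCompact_Icc.image_of_continuousOn hx).prod hK).exists_bound_of_continuousOn
    hL.continuousOn
  have hcont : ContinuousOn (fun s => L (x s) (u s)) (Icc a b \ (D : Set ℝ)) :=
    hL.comp_continuousOn ((hx.mono sdiff_subset).prodMk hD)
  have hae : (Icc a b \ (D : Set ℝ) : Set ℝ) =ᵐ[volume] Icc a b :=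
    sdiff_null_ae_eq_self (D.finite_toSet.measure_zero volume)
  have hmeas := hcont.aestronglyMeasurable (μ := volume)
    (measurableSet_Icc.diff D.finite_toSet.measurableSet)
  rw [Measure.restrict_congr_set hae] at hmeas
  refine IntegrableOn.of_bound measure_Icc_lt_top hmeas C ?_
  filter_upwards [ae_restrict_mem measurableSet_Icc] with s hs
  exact hC (x s, u s) ⟨mem_image_of_mem x hs, huK s hs⟩

theorem IsAdmissible.integrableOn_runningCost {n m : ℕ} {f : Vec n → Vec m → Vec n}
    {Uset : Set (Vec m)} {Ω : Set (Vec n)} {t T : ℝ} {xt : Vec n} {u : ℝ → Vec m}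
    {x : ℝ → Vec n} {L : Vec n → Vec m → ℝ} (h : IsAdmissible f Uset Ω t T xt u x)
    (hU : IsCompact Uset) (hL : Continuous fun p : Vec n × Vec m => L p.1 p.2) :
    IntegrableOn (fun s => L (x s) (u s)) (Icc t (t + T)) :=
  h.pc.integrableOn_runningCost hL hU
    (fun s hs => (h.traj s hs).continuousAt.continuousWithinAt) h.memU

/-- The tail of an admissible control is admissible at the state reached by then. -/
theorem IsAdmissible.tail {n m : ℕ} {f : Vec n → Vec m → Vec n} {Uset : Set (Vec m)}
    {Ω : Set (Vec n)} {t T δ : ℝ} {xt : Vec n} {u : ℝ → Vec m} {x : ℝ → Vec n}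
    (h : IsAdmissible f Uset Ω t T xt u x) (hδ : 0 ≤ δ) :
    IsAdmissible f Uset Ω (t + δ) (T - δ) (x (t + δ)) u x := by
  have hend : t + δ + (T - δ) = t + T := by ring
  have hsub : Icc (t + δ) (t + δ + (T - δ)) ⊆ Icc t (t + T) :=
    Icc_subset_Icc (by linarith) hend.le
  obtain ⟨D, hD⟩ := h.pc
  exact
    { pc := ⟨D, hD.mono (sdiff_subset_sdiff_left hsub)⟩
      memU := fun s hs => h.memU s (hsub hs)
      traj := fun s hs => h.traj s (hsub hs)
      init := rfl
      term := hend ▸ h.term }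

/-- **Inequality (A.2).** If `(ūⁱ, T̄_i)` minimizes `P(t_i, x*(t_i))` with
`T̄_i ≥ T_min + δ`, and `P(t_i + δ, x̄ⁱ(t_i+δ))` with updated coefficients
attains its minimum, then the update inequality (3.2) implies
`V(x*(t_i+δ)) − V(x*(t_i)) ≤ −ξ ε_i ∫_{t_i}^{t_i+δ} L(x̄ⁱ, ūⁱ)`. -/
theorem value_decrease_after_update_case_A {n m : ℕ}
    (f : Vec n → Vec m → Vec n) (L₀ : ℝ)
    (hf : ContDiff ℝ 1 (fun p : Vec n × Vec m => f p.1 p.2))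
    (hf0 : f 0 0 = 0) (hL₀ : 0 < L₀)
    (hlip : ∀ (x₁ x₂ : Vec n) (u : Vec m), ‖f x₁ u - f x₂ u‖ ≤ L₀ * ‖x₁ - x₂‖)
    (umin umax : Vec m) (hU : ∀ j, umin j < 0 ∧ 0 < umax j)
    (Ω : Set (Vec n)) (hΩcl : IsClosed Ω) (hΩbd : Bornology.IsBounded Ω)
    (hΩsc : SimplyConnectedSpace Ω) (hΩ0 : (0 : Vec n) ∈ Ω)
    (δ Tmin : ℝ) (hδ : 0 < δ) (hTmin : δ ≤ Tmin)
    (L : Vec n → Vec m → ℝ)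
    (hLC1 : ContDiff ℝ 1 (fun p : Vec n × Vec m => L p.1 p.2))
    (hL00 : L 0 0 = 0) (hLnn : ∀ x u, 0 ≤ L x u)
    (q : Vec n → ℝ) (hqC1 : ContDiff ℝ 1 q) (hq0 : q 0 = 0) (hqnn : ∀ x, 0 ≤ q x)
    (ξ : ℝ) (hξ : ξ ∈ Ioo (0:ℝ) 1)
    (εi ρi εi1 ρi1 : ℝ) (hεi : εi ∈ Icc (0:ℝ) 1) (hρi : 1 ≤ ρi)
    (hεi1 : εi1 ∈ Icc (0:ℝ) 1) (hρi1 : 1 ≤ ρi1)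
    (ti : ℝ) (xti : Vec n)
    (ubar : ℝ → Vec m) (Tbar : ℝ) (xbar : ℝ → Vec n)
    (hmin : IsMinimizer f (ControlBox umin umax) Ω L q εi ρi Tmin ti xti ubar Tbar xbar)
    (hTbar : Tmin + δ ≤ Tbar)
    (u2 : ℝ → Vec m) (T2 : ℝ) (x2 : ℝ → Vec n)
    (hmin2 : IsMinimizer f (ControlBox umin umax) Ω L q εi1 ρi1 Tmin
      (ti + δ) (xbar (ti + δ)) u2 T2 x2)
    -- the update inequality (3.2)
    (h32 : (εi1 - εi) * (∫ s in (ti + δ)..(ti + Tbar), L (xbar s) (ubar s))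
        + (ρi1 - ρi) * q (xbar (ti + Tbar))
      ≤ δ + (1 - ξ) * εi * ∫ s in ti..(ti + δ), L (xbar s) (ubar s)) :
    cost L q εi1 ρi1 (ti + δ) T2 x2 u2 - cost L q εi ρi ti Tbar xbar ubar
      ≤ -(ξ * εi) * ∫ s in ti..(ti + δ), L (xbar s) (ubar s) := by
  have hint := hmin.adm.integrableOn_runningCost (isCompact_controlBox umin umax) hLC1.continuous
  have hhead : IntervalIntegrable (fun s => L (xbar s) (ubar s)) volume ti (ti + δ) := by
    refine (hint.mono_set ?_).intervalIntegrable
    rw [uIcc_of_le (by linarith)]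
    exact Icc_subset_Icc le_rfl (by linarith)
  have htail : IntervalIntegrable (fun s => L (xbar s) (ubar s)) volume (ti + δ) (ti + Tbar) := by
    refine (hint.mono_set ?_).intervalIntegrable
    rw [uIcc_of_le (by linarith)]
    exact Icc_subset_Icc (by linarith) le_rfl
  have hsplit := intervalIntegral.integral_add_adjacent_intervals hhead htail
  have hopt := hmin2.opt ubar (Tbar - δ) xbar (by linarith) (hmin.adm.tail hδ.le)
  have hend : ti + δ + (Tbar - δ) = ti + Tbar := by ring
  have htailcost : cost L q εi1 ρi1 (ti + δ) (Tbar - δ) xbar ubar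
      = Tbar - δ + εi1 * (∫ s in (ti + δ)..(ti + Tbar), L (xbar s) (ubar s))
        + ρi1 * q (xbar (ti + Tbar)) := by
    rw [cost, hend]
  have hcost : cost L q εi ρi ti Tbar xbar ubar
      = Tbar + εi * ((∫ s in ti..(ti + δ), L (xbar s) (ubar s))
          + ∫ s in (ti + δ)..(ti + Tbar), L (xbar s) (ubar s))
        + ρi * q (xbar (ti + Tbar)) := by
    rw [cost, hsplit]
  rw [htailcost] at hopt
  rw [hcost]
  linarith
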